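/- arXiv:2603.09814 — 8 statements merged into one kernel-verified Lean document; each statement's English description precedes it below -/
import Mathlib

section
/- Let α > 0 and let ω : [0, ∞) → ℝ^n be continuous. Assume that the function t ↦ e^{αt/2}·‖ω(t)‖ is uniformly continuous on [0, ∞) and that ∫₀^∞ e^{αt}·‖ω(t)‖² dt < ∞. Then there exists a constant K ≥ 0 such that ‖ω(t)‖ ≤ K·e^{−αt/2} for all t ≥ 0; in particular ω decays exponentially with rate at least α/2. -/
open MeasureTheory Set

/-- A uniformly continuous function on `[a, ∞)` whose square is integrable there is bounded
above. -/
lemma UniformContinuousOn.exists_forall_le_of_integrableOn_sq {f : ℝ → ℝ} {a : ℝ}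
    (hf : UniformContinuousOn f (Set.Ici a))
    (hint : IntegrableOn (fun t => f t ^ 2) (Set.Ici a)) :
    ∃ K : ℝ, 0 ≤ K ∧ ∀ t, a ≤ t → f t ≤ K := by
  obtain ⟨δ, hδ, hclose⟩ := Metric.uniformContinuousOn_iff.1 hf 1 one_pos
  have hd : 0 < δ / 2 := half_pos hδ
  have hI : 0 ≤ ∫ s in Set.Ici a, f s ^ 2 := integral_nonneg fun s => sq_nonneg (f s)
  refine ⟨2 + (∫ s in Set.Ici a, f s ^ 2) / (δ / 2), by positivity, fun t ht => ?_⟩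
  have hsub : Set.Icc t (t + δ / 2) ⊆ Set.Ici a := fun s hs => ht.trans hs.1
  have hlower : ∀ s ∈ Set.Icc t (t + δ / 2), f t - 2 ≤ f s ^ 2 := by
    intro s hs
    have hdist : dist t s < δ := by
      rw [Real.dist_eq, abs_lt]
      constructor <;> linarith [hs.1, hs.2]
    have h := hclose t ht s (hsub hs) hdist
    rw [Real.dist_eq, abs_lt] at h
    nlinarith [sq_nonneg (f s - 1), h.2, sq_nonneg (f s)]
  have hmono : ∫ _ in Set.Icc t (t + δ / 2), (f t - 2) ≤ ∫ s in Set.Icc t (t + δ / 2), f s ^ 2 :=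
    setIntegral_mono_on (integrableOn_const (by simp)) (hint.mono_set hsub)
      measurableSet_Icc hlower
  have hle : ∫ s in Set.Icc t (t + δ / 2), f s ^ 2 ≤ ∫ s in Set.Ici a, f s ^ 2 :=
    setIntegral_mono_set hint (Filter.Eventually.of_forall fun s => sq_nonneg (f s))
      hsub.eventuallyLE
  rw [setIntegral_const, Real.volume_real_Icc_of_le (by linarith), smul_eq_mul,
    add_sub_cancel_left] at hmono
  rw [← sub_le_iff_le_add', le_div_iff₀ hd]
  linarith

/-- If `t ↦ e^{αt/2}‖ω(t)‖` is uniformly continuous on `[0,∞)` and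
`∫₀^∞ e^{αt}‖ω(t)‖² dt < ∞`, then `‖ω(t)‖ ≤ K e^{-αt/2}` for some `K ≥ 0`. -/
theorem exponential_decay_of_weighted_square_integrable {n : ℕ}
    (α : ℝ) (hα : 0 < α)
    (ω : ℝ → EuclideanSpace ℝ (Fin n))
    (hcont : ContinuousOn ω (Set.Ici 0))
    (hUC : UniformContinuousOn (fun t => Real.exp (α * t / 2) * ‖ω t‖) (Set.Ici 0))
    (hInt : MeasureTheory.IntegrableOn
      (fun t => Real.exp (α * t) * ‖ω t‖ ^ 2) (Set.Ici 0)) :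
    ∃ K : ℝ, 0 ≤ K ∧ ∀ t : ℝ, 0 ≤ t → ‖ω t‖ ≤ K * Real.exp (-(α * t) / 2) := by
  have hsq : ∀ t, Real.exp (α * t) * ‖ω t‖ ^ 2 = (Real.exp (α * t / 2) * ‖ω t‖) ^ 2 := by
    intro t
    rw [mul_pow, ← Real.exp_nat_mul]
    congr 2
    push_cast
    ring
  simp only [hsq] at hInt
  obtain ⟨K, hK, hbound⟩ := hUC.exists_forall_le_of_integrableOn_sq hInt
  refine ⟨K, hK, fun t ht => ?_⟩
  rw [neg_div, Real.exp_neg, ← div_eq_mul_inv, le_div_iff₀ (Real.exp_pos _), mul_comm]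
  exact hbound t ht
end

section
/- Consider problem (P-s) with θ̃ and φ̃ additionally restricted to lie in the range of Cᵀ. Then any two global minimizers of this restricted problem coincide; i.e., the problem admits at most one global minimizer. -/
open Matrix

/-- Objective of problem (P-s): `F(f(s)) + (1/2) ωᵀ D ω`. -/
noncomputable def objPs {n : ℕ} (d : Fin n → ℝ) (F f : Fin n → ℝ → ℝ) (ω s : Fin n → ℝ) : ℝ :=
  (∑ i, F i (f i (s i))) + (1 / 2) * (ω ⬝ᵥ (Matrix.diagonal d *ᵥ ω))

/-- Feasibility for problem (P-s): `f(s) − p − Dω − CBθ̃ = 0` and `f(s) − p − CBφ̃ = 0`. -/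
def feasPs {n m : ℕ} (C : Matrix (Fin n) (Fin m) ℝ) (b : Fin m → ℝ) (d : Fin n → ℝ)
    (p : Fin n → ℝ) (f : Fin n → ℝ → ℝ)
    (θ : Fin m → ℝ) (ω s : Fin n → ℝ) (φ : Fin m → ℝ) : Prop :=
  (∀ i, f i (s i) - p i - (Matrix.diagonal d *ᵥ ω) i
      - ((C * Matrix.diagonal b) *ᵥ θ) i = 0) ∧
  (∀ i, f i (s i) - p i - ((C * Matrix.diagonal b) *ᵥ φ) i = 0)

/-- `θ` lies in the range of `Cᵀ`. -/
def inRangeCT {n m : ℕ} (C : Matrix (Fin n) (Fin m) ℝ) (θ : Fin m → ℝ) : Prop :=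
  ∃ x : Fin n → ℝ, Cᵀ *ᵥ x = θ

/-- Global minimizer of the restricted problem (P-s), where `θ̃` and `φ̃` are restricted
to the range of `Cᵀ`. -/
def isMinPsR {n m : ℕ} (C : Matrix (Fin n) (Fin m) ℝ) (b : Fin m → ℝ) (d : Fin n → ℝ)
    (p : Fin n → ℝ) (F f : Fin n → ℝ → ℝ)
    (θ : Fin m → ℝ) (ω s : Fin n → ℝ) (φ : Fin m → ℝ) : Prop :=
  feasPs C b d p f θ ω s φ ∧ inRangeCT C θ ∧ inRangeCT C φ ∧
  ∀ θ' : Fin m → ℝ, ∀ ω' s' : Fin n → ℝ, ∀ φ' : Fin m → ℝ,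
    feasPs C b d p f θ' ω' s' φ' → inRangeCT C θ' → inRangeCT C φ' →
      objPs d F f ω s ≤ objPs d F f ω' s'

/-- Right multiplication of `C` by a positive diagonal matrix is injective on the range of `Cᵀ`. -/
theorem mul_diagonal_mulVec_injOn_range_transpose {n m : ℕ} (C : Matrix (Fin n) (Fin m) ℝ)
    {b : Fin m → ℝ} (hb : ∀ i, 0 < b i) {θ₁ θ₂ : Fin m → ℝ}
    (h₁ : inRangeCT C θ₁) (h₂ : inRangeCT C θ₂)
    (h : (C * Matrix.diagonal b) *ᵥ θ₁ = (C * Matrix.diagonal b) *ᵥ θ₂) : θ₁ = θ₂ := by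
  obtain ⟨x, hx⟩ := h₁
  obtain ⟨y, hy⟩ := h₂
  have hker : (C * Matrix.diagonal b) *ᵥ (θ₁ - θ₂) = 0 := by
    rw [Matrix.mulVec_sub, h, sub_self]
  have hrange : (x - y) ᵥ* C = θ₁ - θ₂ := by
    rw [← Matrix.mulVec_transpose, Matrix.mulVec_sub, hx, hy]
  have hform : (θ₁ - θ₂) ⬝ᵥ (Matrix.diagonal b *ᵥ (θ₁ - θ₂)) = 0 := by
    rw [← hrange, ← Matrix.dotProduct_mulVec, hrange, Matrix.mulVec_mulVec, hker,
      dotProduct_zero]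
  simp only [dotProduct, Matrix.mulVec_diagonal] at hform
  have hnonneg : ∀ i ∈ Finset.univ, 0 ≤ (θ₁ - θ₂) i * (b i * (θ₁ - θ₂) i) := fun i _ => by
    nlinarith [mul_nonneg (hb i).le (mul_self_nonneg ((θ₁ - θ₂) i))]
  funext i
  have hi := (Finset.sum_eq_zero_iff_of_nonneg hnonneg).1 hform i (Finset.mem_univ i)
  simpa [(hb i).ne', sub_eq_zero] using hi

/-- Feasibility is preserved under midpoints in the variables `(θ, ω, f(s), φ)`. -/
theorem feasPs_midpoint {n m : ℕ} {C : Matrix (Fin n) (Fin m) ℝ} {b : Fin m → ℝ}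
    {d p : Fin n → ℝ} {f : Fin n → ℝ → ℝ} {θ₁ θ₂ φ₁ φ₂ : Fin m → ℝ} {ω₁ ω₂ s₁ s₂ s : Fin n → ℝ}
    (h₁ : feasPs C b d p f θ₁ ω₁ s₁ φ₁) (h₂ : feasPs C b d p f θ₂ ω₂ s₂ φ₂)
    (hs : ∀ i, f i (s i) = (1 / 2) * f i (s₁ i) + (1 / 2) * f i (s₂ i)) :
    feasPs C b d p f ((1 / 2 : ℝ) • (θ₁ + θ₂)) ((1 / 2 : ℝ) • (ω₁ + ω₂)) s
      ((1 / 2 : ℝ) • (φ₁ + φ₂)) := by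
  constructor <;> intro i <;>
    simp only [Matrix.mulVec_smul, Matrix.mulVec_add, Pi.smul_apply, Pi.add_apply, smul_eq_mul, hs]
  · linarith [h₁.1 i, h₂.1 i]
  · linarith [h₁.2 i, h₂.2 i]

theorem inRangeCT_midpoint {n m : ℕ} {C : Matrix (Fin n) (Fin m) ℝ} {θ₁ θ₂ : Fin m → ℝ}
    (h₁ : inRangeCT C θ₁) (h₂ : inRangeCT C θ₂) : inRangeCT C ((1 / 2 : ℝ) • (θ₁ + θ₂)) := by
  obtain ⟨x, rfl⟩ := h₁
  obtain ⟨y, rfl⟩ := h₂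
  exact ⟨(1 / 2 : ℝ) • (x + y), by rw [Matrix.mulVec_smul, Matrix.mulVec_add]⟩

theorem objPs_eq_sum {n : ℕ} (d : Fin n → ℝ) (F f : Fin n → ℝ → ℝ) (ω s : Fin n → ℝ) :
    objPs d F f ω s = ∑ i, (F i (f i (s i)) + (1 / 2) * (d i * ω i ^ 2)) := by
  simp only [objPs, dotProduct, Matrix.mulVec_diagonal, Finset.sum_add_distrib, Finset.mul_sum]
  congr 1
  exact Finset.sum_congr rfl fun i _ => by ring

/-- If the objective at the midpoint of `(f(s₁), ω₁)` and `(f(s₂), ω₂)` is at least the average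
of the objectives, then the two points agree. -/
theorem eq_of_average_le_objPs_midpoint {n : ℕ} {d : Fin n → ℝ} (hd : ∀ i, 0 < d i)
    {F f : Fin n → ℝ → ℝ} (hF : ∀ i, StrictConvexOn ℝ Set.univ (F i)) {ω₁ ω₂ s₁ s₂ s : Fin n → ℝ}
    (hs : ∀ i, f i (s i) = (1 / 2) * f i (s₁ i) + (1 / 2) * f i (s₂ i))
    (h : objPs d F f ω₁ s₁ + objPs d F f ω₂ s₂ ≤
      2 * objPs d F f ((1 / 2 : ℝ) • (ω₁ + ω₂)) s) (i : Fin n) :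
    f i (s₁ i) = f i (s₂ i) ∧ ω₁ i = ω₂ i := by
  have hFle (j) : 2 * F j (f j (s j)) ≤ F j (f j (s₁ j)) + F j (f j (s₂ j)) := by
    have := (hF j).convexOn.2 (Set.mem_univ (f j (s₁ j))) (Set.mem_univ (f j (s₂ j)))
      one_half_pos.le one_half_pos.le (add_halves 1)
    simp only [smul_eq_mul, ← hs] at this
    linarith
  have hquad (j) : 2 * (d j * ((1 / 2) * (ω₁ j + ω₂ j)) ^ 2) =
      d j * ω₁ j ^ 2 + d j * ω₂ j ^ 2 - d j * (ω₁ j - ω₂ j) ^ 2 / 2 := by ring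
  have hsq (j) : 0 ≤ d j * (ω₁ j - ω₂ j) ^ 2 := mul_nonneg (hd j).le (sq_nonneg _)
  simp only [objPs_eq_sum, ← Finset.sum_add_distrib, Finset.mul_sum, Pi.smul_apply, Pi.add_apply,
    smul_eq_mul] at h
  by_contra hne
  refine h.not_gt (Finset.sum_lt_sum (fun j _ => ?_) ⟨i, Finset.mem_univ i, ?_⟩)
  · linarith [hFle j, hquad j, hsq j]
  · by_cases hu : f i (s₁ i) = f i (s₂ i)
    · have hω : ω₁ i - ω₂ i ≠ 0 := fun h0 => hne ⟨hu, sub_eq_zero.1 h0⟩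
      have : 0 < d i * (ω₁ i - ω₂ i) ^ 2 := mul_pos (hd i) (by positivity)
      linarith [hFle i, hquad i]
    · have := (hF i).2 (Set.mem_univ _) (Set.mem_univ _) hu
        one_half_pos one_half_pos (add_halves 1)
      simp only [smul_eq_mul, ← hs] at this
      linarith [hquad i, hsq i]

/-- The restricted problem (P-s) admits at most one global minimizer. -/
theorem restricted_Ps_minimizer_unique {n m : ℕ}
    (C : Matrix (Fin n) (Fin m) ℝ)
    (b : Fin m → ℝ) (hb : ∀ i, 0 < b i)
    (d : Fin n → ℝ) (hd : ∀ i, 0 < d i)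
    (p : Fin n → ℝ)
    (F : Fin n → ℝ → ℝ)
    (hFconv : ∀ i, StrictConvexOn ℝ Set.univ (F i))
    (hFdiff : ∀ i, Differentiable ℝ (F i))
    (f : Fin n → ℝ → ℝ)
    (hfmono : ∀ i, StrictMono (f i))
    (hfbij : ∀ i, Function.Bijective (f i))
    (hf0 : ∀ i, f i 0 = 0)
    (θ₁ : Fin m → ℝ) (ω₁ s₁ : Fin n → ℝ) (φ₁ : Fin m → ℝ)
    (θ₂ : Fin m → ℝ) (ω₂ s₂ : Fin n → ℝ) (φ₂ : Fin m → ℝ)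
    (h₁ : isMinPsR C b d p F f θ₁ ω₁ s₁ φ₁)
    (h₂ : isMinPsR C b d p F f θ₂ ω₂ s₂ φ₂) :
    θ₁ = θ₂ ∧ ω₁ = ω₂ ∧ s₁ = s₂ ∧ φ₁ = φ₂ := by
  obtain ⟨hfeas₁, hθ₁, hφ₁, hmin₁⟩ := h₁
  obtain ⟨hfeas₂, hθ₂, hφ₂, hmin₂⟩ := h₂
  choose s hs using fun i =>
    (hfbij i).surjective ((1 / 2) * f i (s₁ i) + (1 / 2) * f i (s₂ i))
  have hfeas := feasPs_midpoint hfeas₁ hfeas₂ hs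
  have hθ := inRangeCT_midpoint hθ₁ hθ₂
  have hφ := inRangeCT_midpoint hφ₁ hφ₂
  have heq := eq_of_average_le_objPs_midpoint hd hFconv hs
    (by linarith [hmin₁ _ _ _ _ hfeas hθ hφ, hmin₂ _ _ _ _ hfeas hθ hφ])
  have hω : ω₁ = ω₂ := funext fun i => (heq i).2
  have hs₁₂ : s₁ = s₂ := funext fun i => (hfbij i).injective (heq i).1
  subst hω hs₁₂
  refine ⟨mul_diagonal_mulVec_injOn_range_transpose C hb hθ₁ hθ₂ (funext fun i => ?_), rfl, rfl,
    mul_diagonal_mulVec_injOn_range_transpose C hb hφ₁ hφ₂ (funext fun i => ?_)⟩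
  · linarith [hfeas₁.1 i, hfeas₂.1 i]
  · linarith [hfeas₁.2 i, hfeas₂.2 i]
end

section
/- Suppose each f_i is differentiable with f_i'(x) > 0 for every x ∈ ℝ. Fix a primal point (θ̃, ω, s, φ̃) ∈ ℝ^m × ℝ^n × ℝ^n × ℝ^m. If two multiplier pairs (ν¹, λ¹) and (ν², λ²) in ℝ^n × ℝ^n both satisfy the stationarity conditions of problem (P-s) at this point — BCᵀν = 0, D(ω − ν) = 0, f_i'(s_i)·(F_i'(f_i(s_i)) + ν_i + λ_i) = 0 for every i, and BCᵀλ = 0 — then ν¹ = ν² and λ¹ = λ². -/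
open Matrix

/-- Uniqueness of the Lagrange multipliers satisfying the stationarity
conditions of problem (P-s) at a fixed primal point. -/
theorem multipliers_unique {n m : ℕ}
    (C : Matrix (Fin n) (Fin m) ℝ)
    (b : Fin m → ℝ) (hb : ∀ i, 0 < b i)
    (d : Fin n → ℝ) (hd : ∀ i, 0 < d i)
    (p : Fin n → ℝ)
    (F : Fin n → ℝ → ℝ)
    (hFconv : ∀ i, StrictConvexOn ℝ Set.univ (F i))
    (hFdiff : ∀ i, Differentiable ℝ (F i))
    (f : Fin n → ℝ → ℝ)
    (hfmono : ∀ i, StrictMono (f i))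
    (hfbij : ∀ i, Function.Bijective (f i))
    (hf0 : ∀ i, f i 0 = 0)
    (hfdiff : ∀ i, Differentiable ℝ (f i))
    (hf' : ∀ i x, 0 < deriv (f i) x)
    (θ : Fin m → ℝ) (ω s : Fin n → ℝ) (φ : Fin m → ℝ)
    (ν₁ lam₁ ν₂ lam₂ : Fin n → ℝ)
    -- stationarity for (ν₁, lam₁)
    (h₁a : Matrix.diagonal b *ᵥ (Cᵀ *ᵥ ν₁) = 0)
    (h₁b : Matrix.diagonal d *ᵥ (ω - ν₁) = 0)
    (h₁c : ∀ i, deriv (f i) (s i) * (deriv (F i) (f i (s i)) + ν₁ i + lam₁ i) = 0)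
    (h₁d : Matrix.diagonal b *ᵥ (Cᵀ *ᵥ lam₁) = 0)
    -- stationarity for (ν₂, lam₂)
    (h₂a : Matrix.diagonal b *ᵥ (Cᵀ *ᵥ ν₂) = 0)
    (h₂b : Matrix.diagonal d *ᵥ (ω - ν₂) = 0)
    (h₂c : ∀ i, deriv (f i) (s i) * (deriv (F i) (f i (s i)) + ν₂ i + lam₂ i) = 0)
    (h₂d : Matrix.diagonal b *ᵥ (Cᵀ *ᵥ lam₂) = 0) :
    ν₁ = ν₂ ∧ lam₁ = lam₂ := by
  have key : ∀ ν : Fin n → ℝ, Matrix.diagonal d *ᵥ (ω - ν) = 0 → ω = ν := by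
    intro ν h
    funext i
    have hi := congrFun h i
    rw [Matrix.mulVec_diagonal, Pi.zero_apply] at hi
    exact sub_eq_zero.mp ((mul_eq_zero.mp hi).resolve_left (hd i).ne')
  have hν : ν₁ = ν₂ := (key ν₁ h₁b).symm.trans (key ν₂ h₂b)
  refine ⟨hν, funext fun i => ?_⟩
  have h := mul_left_cancel₀ (hf' i (s i)).ne' ((h₁c i).trans (h₂c i).symm)
  rw [hν] at h
  exact add_left_cancel h
end

section
/- Consider problems (P-s) and (OPT-SS), each with the angle variables (θ̃ and φ̃ in (P-s); θ̃ in (OPT-SS)) restricted to lie in the range of Cᵀ. A point (θ̃*, ω*, s*, φ̃*) is a global minimizer of the restricted problem (P-s) if and only if θ̃* = φ̃* and (θ̃*, ω*, f(s*)) is a global minimizer of the restricted problem (OPT-SS). -/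
open Matrix

/-- Feasibility for problem (OPT-SS): `u − p − Dω − CBθ̃ = 0` and `u − p − CBθ̃ = 0`. -/
def feasOptSS {n m : ℕ} (C : Matrix (Fin n) (Fin m) ℝ) (b : Fin m → ℝ) (d : Fin n → ℝ)
    (p : Fin n → ℝ) (θ : Fin m → ℝ) (ω u : Fin n → ℝ) : Prop :=
  (∀ i, u i - p i - (Matrix.diagonal d *ᵥ ω) i - ((C * Matrix.diagonal b) *ᵥ θ) i = 0) ∧
  (∀ i, u i - p i - ((C * Matrix.diagonal b) *ᵥ θ) i = 0)

/-- Global minimizer of the restricted problem (OPT-SS). -/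
def isMinOptSSR {n m : ℕ} (C : Matrix (Fin n) (Fin m) ℝ) (b : Fin m → ℝ) (d : Fin n → ℝ)
    (p : Fin n → ℝ) (F : Fin n → ℝ → ℝ)
    (θ : Fin m → ℝ) (ω u : Fin n → ℝ) : Prop :=
  feasOptSS C b d p θ ω u ∧ inRangeCT C θ ∧
  ∀ θ' : Fin m → ℝ, ∀ ω' u' : Fin n → ℝ,
    feasOptSS C b d p θ' ω' u' → inRangeCT C θ' →
      (∑ i, F i (u i)) ≤ (∑ i, F i (u' i))

theorem diagonal_quadForm_eq {ι : Type*} [Fintype ι] [DecidableEq ι] (d v : ι → ℝ) :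
    v ⬝ᵥ (Matrix.diagonal d *ᵥ v) = ∑ i, d i * v i ^ 2 := by
  simp only [dotProduct, mulVec_diagonal]
  exact Finset.sum_congr rfl fun i _ => by ring

theorem diagonal_quadForm_nonneg {ι : Type*} [Fintype ι] [DecidableEq ι] {d : ι → ℝ}
    (hd : ∀ i, 0 < d i) (v : ι → ℝ) : 0 ≤ v ⬝ᵥ (Matrix.diagonal d *ᵥ v) := by
  rw [diagonal_quadForm_eq]
  exact Finset.sum_nonneg fun i _ => mul_nonneg (hd i).le (sq_nonneg _)

theorem eq_zero_of_diagonal_quadForm_nonpos {ι : Type*} [Fintype ι] [DecidableEq ι] {d : ι → ℝ}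
    (hd : ∀ i, 0 < d i) {v : ι → ℝ} (h : v ⬝ᵥ (Matrix.diagonal d *ᵥ v) ≤ 0) : v = 0 := by
  have h0 := le_antisymm h (diagonal_quadForm_nonneg hd v)
  rw [diagonal_quadForm_eq, Finset.sum_eq_zero_iff_of_nonneg
    fun i _ => mul_nonneg (hd i).le (sq_nonneg _)] at h0
  funext i
  simpa [(hd i).ne'] using h0 i (Finset.mem_univ i)

/-- `C B` is injective on the range of `Cᵀ` when `B` is diagonal and positive. -/
theorem inRangeCT.eq_of_mulVec_eq {n m : ℕ} {C : Matrix (Fin n) (Fin m) ℝ} {b : Fin m → ℝ}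
    (hb : ∀ i, 0 < b i) {θ φ : Fin m → ℝ} (hθ : inRangeCT C θ) (hφ : inRangeCT C φ)
    (h : (C * Matrix.diagonal b) *ᵥ θ = (C * Matrix.diagonal b) *ᵥ φ) : θ = φ := by
  obtain ⟨x, rfl⟩ := hθ
  obtain ⟨y, rfl⟩ := hφ
  have hz : C *ᵥ (Matrix.diagonal b *ᵥ (Cᵀ *ᵥ (x - y))) = 0 := by
    rw [mulVec_mulVec, mulVec_sub, mulVec_sub, h, sub_self]
  have hq : (Cᵀ *ᵥ (x - y)) ⬝ᵥ (Matrix.diagonal b *ᵥ (Cᵀ *ᵥ (x - y))) ≤ 0 := by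
    conv_lhs => rw [mulVec_transpose C (x - y), ← dotProduct_mulVec, ← mulVec_transpose, hz]
    simp
  have h0 := eq_zero_of_diagonal_quadForm_nonpos hb hq
  rwa [mulVec_sub, sub_eq_zero] at h0

theorem feasOptSS.freq_eq_zero {n m : ℕ} {C : Matrix (Fin n) (Fin m) ℝ} {b : Fin m → ℝ}
    {d : Fin n → ℝ} (hd : ∀ i, 0 < d i) {p : Fin n → ℝ} {θ : Fin m → ℝ} {ω u : Fin n → ℝ}
    (h : feasOptSS C b d p θ ω u) : ω = 0 := by
  funext i
  have h1 := h.1 i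
  have h2 := h.2 i
  rw [mulVec_diagonal] at h1
  have h3 : d i * ω i = 0 := by linarith
  simpa [(hd i).ne'] using h3

/-- Equivalence of the restricted problems (P-s) and (OPT-SS):
`(θ̃*, ω*, s*, φ̃*)` minimizes the restricted (P-s) iff `θ̃* = φ̃*` and
`(θ̃*, ω*, f(s*))` minimizes the restricted (OPT-SS). -/
theorem restricted_Ps_iff_restricted_OptSS {n m : ℕ}
    (C : Matrix (Fin n) (Fin m) ℝ)
    (b : Fin m → ℝ) (hb : ∀ i, 0 < b i)
    (d : Fin n → ℝ) (hd : ∀ i, 0 < d i)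
    (p : Fin n → ℝ)
    (F : Fin n → ℝ → ℝ)
    (hFconv : ∀ i, StrictConvexOn ℝ Set.univ (F i))
    (hFdiff : ∀ i, Differentiable ℝ (F i))
    (f : Fin n → ℝ → ℝ)
    (hfmono : ∀ i, StrictMono (f i))
    (hfbij : ∀ i, Function.Bijective (f i))
    (hf0 : ∀ i, f i 0 = 0)
    (θs : Fin m → ℝ) (ωs ss : Fin n → ℝ) (φs : Fin m → ℝ) :
    isMinPsR C b d p F f θs ωs ss φs ↔
      (θs = φs ∧ isMinOptSSR C b d p F θs ωs (fun i => f i (ss i))) := by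
  constructor
  · rintro ⟨hfeas, hθ, hφ, hmin⟩
    have hω : ωs = 0 := by
      have h := hmin φs 0 ss φs ⟨fun i => by simpa using hfeas.2 i, hfeas.2⟩ hφ hφ
      apply eq_zero_of_diagonal_quadForm_nonpos hd
      simp only [objPs, zero_dotProduct] at h
      linarith
    subst hω
    have hθφ : θs = φs := by
      refine hθ.eq_of_mulVec_eq hb hφ (funext fun i => ?_)
      have h1 := hfeas.1 i
      have h2 := hfeas.2 i
      simp only [mulVec_zero, Pi.zero_apply] at h1
      linarith
    subst hθφ
    refine ⟨rfl, hfeas, hθ, fun θ' ω' u' h' hθ' => ?_⟩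
    obtain rfl := h'.freq_eq_zero hd
    choose s' hs' using fun i => (hfbij i).surjective (u' i)
    obtain rfl : (fun i => f i (s' i)) = u' := funext hs'
    simpa [objPs] using hmin θ' 0 s' θ' h' hθ' hθ'
  · rintro ⟨rfl, hfeas, hθ, hmin⟩
    refine ⟨hfeas, hθ, hθ, fun θ' ω' s' φ' h' _ hφ' => ?_⟩
    obtain rfl := hfeas.freq_eq_zero hd
    have h := hmin φ' 0 (fun i => f i (s' i)) ⟨fun i => by simpa using h'.2 i, h'.2⟩ hφ'
    have hq := diagonal_quadForm_nonneg hd ω'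
    simp only [objPs, zero_dotProduct]
    linarith
end

section
/- If (θ̃*, ω*, u*, φ̃*) is a global minimizer of problem (P-u), then ω* = 0. -/
open Matrix

/-- Objective of problem (P-u): `F(u) + (1/2) ωᵀ D ω`. -/
noncomputable def objPu {n : ℕ} (d : Fin n → ℝ) (F : Fin n → ℝ → ℝ) (ω u : Fin n → ℝ) : ℝ :=
  (∑ i, F i (u i)) + (1 / 2) * (ω ⬝ᵥ (Matrix.diagonal d *ᵥ ω))

/-- Feasibility for problem (P-u): `u − p − Dω − CBθ̃ = 0` and `u − p − CBφ̃ = 0`. -/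
def feasPu {n m : ℕ} (C : Matrix (Fin n) (Fin m) ℝ) (b : Fin m → ℝ) (d : Fin n → ℝ)
    (p : Fin n → ℝ) (θ : Fin m → ℝ) (ω u : Fin n → ℝ) (φ : Fin m → ℝ) : Prop :=
  (∀ i, u i - p i - (Matrix.diagonal d *ᵥ ω) i - ((C * Matrix.diagonal b) *ᵥ θ) i = 0) ∧
  (∀ i, u i - p i - ((C * Matrix.diagonal b) *ᵥ φ) i = 0)

/-- Global minimizer of problem (P-u). -/
def isMinPu {n m : ℕ} (C : Matrix (Fin n) (Fin m) ℝ) (b : Fin m → ℝ) (d : Fin n → ℝ)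
    (p : Fin n → ℝ) (F : Fin n → ℝ → ℝ)
    (θ : Fin m → ℝ) (ω u : Fin n → ℝ) (φ : Fin m → ℝ) : Prop :=
  feasPu C b d p θ ω u φ ∧
  ∀ θ' : Fin m → ℝ, ∀ ω' u' : Fin n → ℝ, ∀ φ' : Fin m → ℝ,
    feasPu C b d p θ' ω' u' φ' → objPu d F ω u ≤ objPu d F ω' u'

/-- At any global minimizer of problem (P-u), the frequency deviation
vanishes: `ω* = 0`. -/
theorem omega_eq_zero_at_Pu_minimizer {n m : ℕ}
    (C : Matrix (Fin n) (Fin m) ℝ)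
    (b : Fin m → ℝ) (hb : ∀ i, 0 < b i)
    (d : Fin n → ℝ) (hd : ∀ i, 0 < d i)
    (p : Fin n → ℝ)
    (F : Fin n → ℝ → ℝ)
    (hFconv : ∀ i, StrictConvexOn ℝ Set.univ (F i))
    (hFdiff : ∀ i, Differentiable ℝ (F i))
    (θs : Fin m → ℝ) (ωs us : Fin n → ℝ) (φs : Fin m → ℝ)
    (hmin : isMinPu C b d p F θs ωs us φs) :
    ωs = 0 := by
  have hle := hmin.2 φs 0 us φs ⟨fun i => by simpa using hmin.1.2 i, hmin.1.2⟩
  simp only [objPu, dotProduct, mulVec_diagonal, Pi.zero_apply,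
    Finset.sum_const_zero, mul_zero] at hle
  have hnonneg : ∀ i ∈ Finset.univ, 0 ≤ ωs i * (d i * ωs i) := fun i _ => by
    nlinarith [mul_nonneg (hd i).le (mul_self_nonneg (ωs i))]
  have hsum : ∑ i, ωs i * (d i * ωs i) = 0 :=
    le_antisymm (by linarith) (Finset.sum_nonneg hnonneg)
  funext i
  simpa [(hd i).ne'] using (Finset.sum_eq_zero_iff_of_nonneg hnonneg).1 hsum i (Finset.mem_univ i)
end

section
/- If (θ̃¹, ω¹, u¹, φ̃¹) and (θ̃², ω², u², φ̃²) are both global minimizers of problem (P-u), then u¹ = u² and ω¹ = ω² = 0. -/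
open Matrix

/-- Feasibility with zero frequency deviation only involves the second constraint. -/
lemma feasPu_zero {n m : ℕ} {C : Matrix (Fin n) (Fin m) ℝ} {b : Fin m → ℝ} {d : Fin n → ℝ}
    {p u : Fin n → ℝ} {φ : Fin m → ℝ}
    (h : ∀ i, u i - p i - ((C * Matrix.diagonal b) *ᵥ φ) i = 0) :
    feasPu C b d p φ 0 u φ :=
  ⟨fun i => by simpa using h i, h⟩

/-- A minimizer of (P-u) has zero frequency deviation. -/
lemma isMinPu.omega_eq_zero {n m : ℕ} {C : Matrix (Fin n) (Fin m) ℝ} {b : Fin m → ℝ}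
    {d : Fin n → ℝ} (hd : ∀ i, 0 < d i) {p : Fin n → ℝ} {F : Fin n → ℝ → ℝ}
    {θ φ : Fin m → ℝ} {ω u : Fin n → ℝ} (h : isMinPu C b d p F θ ω u φ) : ω = 0 := by
  by_contra hω
  have hle := h.2 _ _ _ _ (feasPu_zero h.1.2)
  have hpos := (Matrix.PosDef.diagonal hd).dotProduct_mulVec_pos hω
  simp only [star_trivial] at hpos
  simp only [objPu, zero_dotProduct] at hle
  linarith

/-- A separable sum of strictly convex functions is strictly midpoint convex. -/
lemma sum_midpoint_lt_of_strictConvexOn {ι : Type*} [Fintype ι] {F : ι → ℝ → ℝ}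
    (hF : ∀ i, StrictConvexOn ℝ Set.univ (F i)) {u v : ι → ℝ} (huv : u ≠ v) :
    ∑ i, F i ((1 / 2) * u i + (1 / 2) * v i) <
      (1 / 2) * ∑ i, F i (u i) + (1 / 2) * ∑ i, F i (v i) := by
  obtain ⟨j, hj⟩ := Function.ne_iff.mp huv
  rw [Finset.mul_sum, Finset.mul_sum, ← Finset.sum_add_distrib]
  refine Finset.sum_lt_sum (fun i _ => ?_) ⟨j, Finset.mem_univ j, ?_⟩
  · exact (hF i).convexOn.2 (Set.mem_univ _) (Set.mem_univ _) (by norm_num) (by norm_num)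
      (by norm_num)
  · exact (hF j).2 (Set.mem_univ _) (Set.mem_univ _) hj (by norm_num) (by norm_num)
      (by norm_num)

/-- Any two global minimizers of problem (P-u) have the same `u`
component, and both have zero frequency deviation. -/
theorem Pu_minimizers_u_unique_omega_zero {n m : ℕ}
    (C : Matrix (Fin n) (Fin m) ℝ)
    (b : Fin m → ℝ) (hb : ∀ i, 0 < b i)
    (d : Fin n → ℝ) (hd : ∀ i, 0 < d i)
    (p : Fin n → ℝ)
    (F : Fin n → ℝ → ℝ)
    (hFconv : ∀ i, StrictConvexOn ℝ Set.univ (F i))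
    (hFdiff : ∀ i, Differentiable ℝ (F i))
    (θ₁ : Fin m → ℝ) (ω₁ u₁ : Fin n → ℝ) (φ₁ : Fin m → ℝ)
    (θ₂ : Fin m → ℝ) (ω₂ u₂ : Fin n → ℝ) (φ₂ : Fin m → ℝ)
    (h₁ : isMinPu C b d p F θ₁ ω₁ u₁ φ₁)
    (h₂ : isMinPu C b d p F θ₂ ω₂ u₂ φ₂) :
    u₁ = u₂ ∧ ω₁ = 0 ∧ ω₂ = 0 := by
  obtain rfl := h₁.omega_eq_zero hd
  obtain rfl := h₂.omega_eq_zero hd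
  refine ⟨?_, rfl, rfl⟩
  by_contra hne
  have hmid : ∀ i, ((1 / 2) * u₁ i + (1 / 2) * u₂ i) - p i -
      ((C * Matrix.diagonal b) *ᵥ ((1 / 2 : ℝ) • φ₁ + (1 / 2 : ℝ) • φ₂)) i = 0 := by
    intro i
    rw [mulVec_add, mulVec_smul, mulVec_smul]
    simp only [Pi.add_apply, Pi.smul_apply, smul_eq_mul]
    linarith [h₁.1.2 i, h₂.1.2 i]
  have hle₁ := h₁.2 _ _ _ _ (feasPu_zero hmid)
  have hle₂ := h₂.2 _ _ _ _ (feasPu_zero hmid)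
  have hlt := sum_midpoint_lt_of_strictConvexOn hFconv hne
  simp only [objPu, zero_dotProduct] at hle₁ hle₂
  linarith
end

section
/- Let M, Γ_λ, Γ_φ be positive-definite diagonal matrices (of sizes n×n, n×n, m×m). Suppose (θ̃*, s*, λ*, φ̃*) satisfies the equilibrium conditions with zero frequency deviation: f(s*) − p − CBθ̃* = 0, F_i'(f_i(s_i*)) + λ_i* = 0 for every i, f(s*) − p − CBφ̃* = 0, and Cᵀλ* = 0. Then for every point (θ̃, ω, s, λ, φ̃) ∈ ℝ^m × ℝ^n × ℝ^n × ℝ^n × ℝ^m the following algebraic identity holds: (θ̃ − θ̃*)ᵀB(Cᵀω) + ωᵀ(f(s) − p − Dω − CBθ̃) + (λ − λ*)ᵀ(f(s) − p − CBφ̃) + (φ̃ − φ̃*)ᵀBCᵀλ + (f(s) − f(s*))ᵀ(−(∇F(f(s)) + ω + λ)) = −ωᵀDω − (∇F(f(s)) − ∇F(f(s*)))ᵀ(f(s) − f(s*)), where ∇F(u) denotes the vector with components F_i'(u_i). -/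
open Matrix

theorem dotProduct_diagonal_transpose_mulVec {n m : ℕ}
    (C : Matrix (Fin n) (Fin m) ℝ) (b x : Fin m → ℝ) (w : Fin n → ℝ) :
    x ⬝ᵥ (Matrix.diagonal b *ᵥ (Cᵀ *ᵥ w)) = w ⬝ᵥ ((C * Matrix.diagonal b) *ᵥ x) := by
  rw [← Matrix.dotProduct_transpose_mulVec (C * Matrix.diagonal b), Matrix.transpose_mul,
    Matrix.diagonal_transpose, Matrix.mulVec_mulVec]

/-- The Lyapunov-derivative identity along the closed-loop vector field:
given the equilibrium conditions with zero frequency deviation, for every point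
`(θ̃, ω, s, λ, φ̃)` one has
`(θ̃−θ̃*)ᵀB(Cᵀω) + ωᵀ(f(s)−p−Dω−CBθ̃) + (λ−λ*)ᵀ(f(s)−p−CBφ̃) + (φ̃−φ̃*)ᵀBCᵀλ
  + (f(s)−f(s*))ᵀ(−(∇F(f(s))+ω+λ))
  = −ωᵀDω − (∇F(f(s))−∇F(f(s*)))ᵀ(f(s)−f(s*))`. -/
theorem lyapunov_derivative_identity {n m : ℕ}
    (C : Matrix (Fin n) (Fin m) ℝ)
    (b : Fin m → ℝ) (hb : ∀ i, 0 < b i)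
    (d : Fin n → ℝ) (hd : ∀ i, 0 < d i)
    (Minertia : Fin n → ℝ) (hM : ∀ i, 0 < Minertia i)
    (Γlam : Fin n → ℝ) (hΓlam : ∀ i, 0 < Γlam i)
    (Γphi : Fin m → ℝ) (hΓphi : ∀ i, 0 < Γphi i)
    (p : Fin n → ℝ)
    (F : Fin n → ℝ → ℝ)
    (hFconv : ∀ i, StrictConvexOn ℝ Set.univ (F i))
    (hFdiff : ∀ i, Differentiable ℝ (F i))
    (f : Fin n → ℝ → ℝ)
    (hfmono : ∀ i, StrictMono (f i))
    (hfbij : ∀ i, Function.Bijective (f i))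
    (hf0 : ∀ i, f i 0 = 0)
    (θstar : Fin m → ℝ) (sstar lamstar : Fin n → ℝ) (φstar : Fin m → ℝ)
    -- equilibrium conditions with zero frequency deviation
    (heq1 : ∀ i, f i (sstar i) - p i - ((C * Matrix.diagonal b) *ᵥ θstar) i = 0)
    (heq2 : ∀ i, deriv (F i) (f i (sstar i)) + lamstar i = 0)
    (heq3 : ∀ i, f i (sstar i) - p i - ((C * Matrix.diagonal b) *ᵥ φstar) i = 0)
    (heq4 : Cᵀ *ᵥ lamstar = 0) :
    ∀ (θ : Fin m → ℝ) (ω s lam : Fin n → ℝ) (φ : Fin m → ℝ),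
      (θ - θstar) ⬝ᵥ (Matrix.diagonal b *ᵥ (Cᵀ *ᵥ ω))
        + ω ⬝ᵥ (fun i => f i (s i) - p i - (Matrix.diagonal d *ᵥ ω) i
            - ((C * Matrix.diagonal b) *ᵥ θ) i)
        + (lam - lamstar) ⬝ᵥ (fun i => f i (s i) - p i
            - ((C * Matrix.diagonal b) *ᵥ φ) i)
        + (φ - φstar) ⬝ᵥ (Matrix.diagonal b *ᵥ (Cᵀ *ᵥ lam))
        + (fun i => f i (s i) - f i (sstar i)) ⬝ᵥ
            (fun i => -(deriv (F i) (f i (s i)) + ω i + lam i))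
      = -(ω ⬝ᵥ (Matrix.diagonal d *ᵥ ω))
        - (fun i => deriv (F i) (f i (s i)) - deriv (F i) (f i (sstar i))) ⬝ᵥ
            (fun i => f i (s i) - f i (sstar i)) := by
  intro θ ω s lam φ
  have hstar : lamstar ⬝ᵥ ((C * Matrix.diagonal b) *ᵥ (φ - φstar)) = 0 := by
    rw [← dotProduct_diagonal_transpose_mulVec, heq4, Matrix.mulVec_zero, dotProduct_zero]
  rw [dotProduct_diagonal_transpose_mulVec, dotProduct_diagonal_transpose_mulVec,
    ← sub_eq_zero, ← hstar]
  simp only [Matrix.mulVec_sub, dotProduct, Pi.sub_apply, ← Finset.sum_add_distrib,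
    ← Finset.sum_sub_distrib, ← Finset.sum_neg_distrib]
  refine Finset.sum_congr rfl fun i _ => ?_
  linear_combination ω i * heq1 i + (lam i - lamstar i) * heq3 i
    - (f i (s i) - f i (sstar i)) * heq2 i
end

section
/- Assume Cᵀ𝟙_n = 0 and ker(Cᵀ) ⊆ span{𝟙_n}, where 𝟙_n ∈ ℝ^n is the all-ones vector. Let (θ̃*, ω*, u*) be a global minimizer of problem (OPT-SS) with θ̃ restricted to lie in the range of Cᵀ. Then all marginal costs are equal at the optimum: F_i'(u_i*) = F_j'(u_j*) for all i, j. -/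
open Matrix

/-- The quadratic form of `C * diagonal b * Cᵀ` is a weighted sum of squares. -/
lemma dotProduct_weighted_gram_mulVec {ι κ : Type*} [Fintype ι] [Fintype κ] [DecidableEq κ]
    (C : Matrix ι κ ℝ) (b : κ → ℝ) (x : ι → ℝ) :
    x ⬝ᵥ ((C * Matrix.diagonal b) *ᵥ (Cᵀ *ᵥ x)) = ∑ k, b k * (Cᵀ *ᵥ x) k ^ 2 := by
  rw [← Matrix.mulVec_mulVec, Matrix.dotProduct_mulVec, ← Matrix.mulVec_transpose]
  simp only [dotProduct, Matrix.mulVec_diagonal]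
  exact Finset.sum_congr rfl fun k _ => by ring

/-- A vector annihilated by a positively weighted Gram form lies in the kernel of `Cᵀ`. -/
lemma transpose_mulVec_eq_zero_of_weighted_gram {ι κ : Type*} [Fintype ι] [Fintype κ]
    [DecidableEq κ] (C : Matrix ι κ ℝ) {b : κ → ℝ} (hb : ∀ k, 0 < b k) {x : ι → ℝ}
    (h : x ⬝ᵥ ((C * Matrix.diagonal b) *ᵥ (Cᵀ *ᵥ x)) = 0) : Cᵀ *ᵥ x = 0 := by
  rw [dotProduct_weighted_gram_mulVec, Finset.sum_eq_zero_iff_of_nonneg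
    fun k _ => mul_nonneg (hb k).le (sq_nonneg _)] at h
  funext k
  simpa [(hb k).ne'] using h k (Finset.mem_univ k)

/-- First-order condition for a separable function minimized along a line. -/
lemma deriv_dotProduct_eq_zero_of_forall_le {ι : Type*} [Fintype ι] {F : ι → ℝ → ℝ} {u : ι → ℝ}
    (hF : ∀ i, DifferentiableAt ℝ (F i) (u i)) (v : ι → ℝ)
    (hmin : ∀ t : ℝ, ∑ i, F i (u i) ≤ ∑ i, F i (u i + t * v i)) :
    (fun i => deriv (F i) (u i)) ⬝ᵥ v = 0 := by
  have hderiv : HasDerivAt (fun t : ℝ => ∑ i, F i (u i + t * v i))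
      (∑ i, deriv (F i) (u i) * v i) 0 := by
    refine HasDerivAt.fun_sum fun i _ => ?_
    have hline : HasDerivAt (fun t : ℝ => u i + t * v i) (v i) 0 := by
      simpa using ((hasDerivAt_id (0 : ℝ)).mul_const (v i)).const_add (u i)
    exact HasDerivAt.comp_of_eq 0 (hF i).hasDerivAt hline (by simp)
  have hlocal : IsLocalMin (fun t : ℝ => ∑ i, F i (u i + t * v i)) 0 :=
    Filter.Eventually.of_forall fun t => by simpa using hmin t
  exact hlocal.hasDerivAt_eq_zero hderiv

/-- For a connected network (`Cᵀ𝟙 = 0` and `ker Cᵀ ⊆ span{𝟙}`), at any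
global minimizer of the restricted (OPT-SS) all marginal costs coincide. -/
theorem marginal_costs_equal_at_optimum {n m : ℕ}
    (C : Matrix (Fin n) (Fin m) ℝ)
    (b : Fin m → ℝ) (hb : ∀ i, 0 < b i)
    (d : Fin n → ℝ) (hd : ∀ i, 0 < d i)
    (p : Fin n → ℝ)
    (F : Fin n → ℝ → ℝ)
    (hFconv : ∀ i, StrictConvexOn ℝ Set.univ (F i))
    (hFdiff : ∀ i, Differentiable ℝ (F i))
    (hC1 : Cᵀ *ᵥ (fun _ => (1 : ℝ)) = 0)
    (hker : ∀ x : Fin n → ℝ, Cᵀ *ᵥ x = 0 → ∃ c : ℝ, x = fun _ => c)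
    (θs : Fin m → ℝ) (ωs us : Fin n → ℝ)
    (hmin : isMinOptSSR C b d p F θs ωs us) :
    ∀ i j, deriv (F i) (us i) = deriv (F j) (us j) := by
  obtain ⟨⟨hfeas₁, hfeas₂⟩, ⟨x, rfl⟩, hle⟩ := hmin
  set g : Fin n → ℝ := fun i => deriv (F i) (us i)
  have hcrit : g ⬝ᵥ ((C * Matrix.diagonal b) *ᵥ (Cᵀ *ᵥ g)) = 0 := by
    refine deriv_dotProduct_eq_zero_of_forall_le (fun i => hFdiff i (us i)) _ fun t => ?_
    refine hle (Cᵀ *ᵥ (x + t • g)) ωs _ ⟨fun i => ?_, fun i => ?_⟩ ⟨_, rfl⟩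
    · have := hfeas₁ i
      simp only [Matrix.mulVec_add, Matrix.mulVec_smul, Pi.add_apply, Pi.smul_apply, smul_eq_mul]
      linarith
    · have := hfeas₂ i
      simp only [Matrix.mulVec_add, Matrix.mulVec_smul, Pi.add_apply, Pi.smul_apply, smul_eq_mul]
      linarith
  obtain ⟨c, hc⟩ := hker g (transpose_mulVec_eq_zero_of_weighted_gram C hb hcrit)
  exact fun i j => (congrFun hc i).trans (congrFun hc j).symm
end
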